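/- Let l ≥ 3, Δ ≥ 3 and n ≥ l + Δ. Let G_a be the unicyclic graph on n vertices obtained from the cycle C_l by attaching Δ−3 pendant vertices and one end-vertex of a path on n−l−Δ+3 vertices to a single cycle vertex (which then has degree Δ). Let G_b be the unicyclic graph on n vertices obtained from the cycle C_l by attaching one end-vertex of a path on n−l−Δ+1 vertices to a cycle vertex and attaching Δ−1 pendant vertices to the other end-vertex of that path (which then has degree Δ). Then Kf(G_a) − Kf(G_b) = (Δ−3)l² + (Δ−3)(Δ−n−4)l − 8n + 12Δ + 3nΔ − 3Δ² − 12. -/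

import Mathlib

open scoped Classical

noncomputable section

namespace KfPaper

variable {V : Type*} {W : Type*}

/-- The energy of a potential `f` on graph `G`, viewing each edge as a unit resistor:
`(1/2) · ∑_{x,y adjacent} (f x - f y)²` (each edge counted twice, hence the `1/2`). -/
def energy [Fintype V] (G : SimpleGraph V) (f : V → ℝ) : ℝ :=
  (1 / 2) * ∑ x : V, ∑ y : V, (if G.Adj x y then (f x - f y) ^ 2 else 0)

/-- The resistance distance (effective resistance) between `u` and `v`:
`r(u,v) = 1 / inf { energy f : f u = 1, f v = 0 }` and `r(u,u) = 0`. -/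
def resistanceDistance [Fintype V] (G : SimpleGraph V) (u v : V) : ℝ :=
  if u = v then 0
  else 1 / sInf {e : ℝ | ∃ f : V → ℝ, f u = 1 ∧ f v = 0 ∧ energy G f = e}

/-- The Kirchhoff index: sum of resistance distances over unordered pairs of distinct
vertices (each ordered pair counted once via the factor `1/2`, diagonal terms vanish). -/
def kirchhoffIndex [Fintype V] (G : SimpleGraph V) : ℝ :=
  (1 / 2) * ∑ u : V, ∑ v : V, resistanceDistance G u v

/-- `Kf_v(G) = ∑_{u ≠ v} r(v,u)` (the term `u = v` contributes `0`). -/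
def kirchhoffAt [Fintype V] (G : SimpleGraph V) (v : V) : ℝ :=
  ∑ u : V, resistanceDistance G v u

/-- The Wiener index: sum of graph distances over unordered pairs of distinct vertices. -/
def wienerIndex [Fintype V] (G : SimpleGraph V) : ℝ :=
  (1 / 2) * ∑ u : V, ∑ v : V, (G.dist u v : ℝ)

/-- `W_v(G) = ∑_u d(v,u)`. -/
def wienerAt [Fintype V] (G : SimpleGraph V) (v : V) : ℝ :=
  ∑ u : V, (G.dist v u : ℝ)

/-- The degree of a vertex. -/
def degree' (G : SimpleGraph V) (v : V) : ℕ := Nat.card (G.neighborSet v)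

/-- `G` has maximum degree `Δ`. -/
def HasMaxDegree (G : SimpleGraph V) (Δ : ℕ) : Prop :=
  (∀ v, degree' G v ≤ Δ) ∧ ∃ v, degree' G v = Δ

/-- A unicyclic graph: a connected graph containing exactly one cycle, equivalently a
connected graph with as many edges as vertices. -/
def IsUnicyclic [Fintype V] (G : SimpleGraph V) : Prop :=
  G.Connected ∧ Nat.card G.edgeSet = Fintype.card V

/-- `G_a`: the unicyclic graph on `Fin n` with the cycle `0,…,l−1`, with `Δ−3` pendant
vertices `l,…,l+Δ−4` attached to the cycle vertex `0`, and one end-vertex of the path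
`l+Δ−3,…,n−1` (on `n−l−Δ+3` vertices) attached to `0` (so `0` has degree `Δ`). -/
def Ga (n l Δ : ℕ) : SimpleGraph (Fin n) :=
  SimpleGraph.fromRel (fun i j =>
    (i.val + 1 = j.val ∧ j.val ≤ l - 1) ∨
    (i.val = 0 ∧ j.val = l - 1) ∨
    (i.val = 0 ∧ l ≤ j.val ∧ j.val ≤ l + Δ - 3) ∨
    (l + Δ - 3 ≤ i.val ∧ i.val + 1 = j.val))

/-- `G_b`: the unicyclic graph on `Fin n` with the cycle `0,…,l−1`, one end-vertex of the
path `l,…,n−Δ` (on `n−l−Δ+1` vertices) attached to the cycle vertex `0`, and `Δ−1`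
pendant vertices `n−Δ+1,…,n−1` attached to the other end-vertex `n−Δ` of the path
(so `n−Δ` has degree `Δ`). -/
def Gb (n l Δ : ℕ) : SimpleGraph (Fin n) :=
  SimpleGraph.fromRel (fun i j =>
    (i.val + 1 = j.val ∧ j.val ≤ l - 1) ∨
    (i.val = 0 ∧ j.val = l - 1) ∨
    (i.val = 0 ∧ j.val = l) ∨
    (l ≤ i.val ∧ i.val + 1 = j.val ∧ j.val ≤ n - Δ) ∨
    (i.val = n - Δ ∧ n - Δ < j.val))

/-- The Dirichlet form polarizing `energy`. -/
def dirichletForm [Fintype V] (G : SimpleGraph V) (f g : V → ℝ) : ℝ :=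
  (1 / 2) * ∑ x : V, ∑ y : V, (if G.Adj x y then (f x - f y) * (g x - g y) else 0)

theorem energy_eq_dirichletForm [Fintype V] (G : SimpleGraph V) (f : V → ℝ) :
    energy G f = dirichletForm G f f := by
  simp only [energy, dirichletForm, sq]

theorem energy_nonneg [Fintype V] (G : SimpleGraph V) (f : V → ℝ) : 0 ≤ energy G f := by
  refine mul_nonneg (by norm_num) (Finset.sum_nonneg fun x _ => Finset.sum_nonneg fun y _ => ?_)
  split_ifs <;> positivity

theorem energy_sub_mul [Fintype V] (G : SimpleGraph V) (f h : V → ℝ) (s : ℝ) :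
    energy G (fun x => f x - s * h x)
      = energy G f - 2 * s * dirichletForm G f h + s ^ 2 * energy G h := by
  simp only [energy, dirichletForm, Finset.mul_sum, ← Finset.sum_sub_distrib,
    ← Finset.sum_add_distrib]
  refine Finset.sum_congr rfl fun x _ => Finset.sum_congr rfl fun y _ => ?_
  split_ifs <;> ring

theorem energy_sub_const_div [Fintype V] (G : SimpleGraph V) (h : V → ℝ) (c R : ℝ) :
    energy G (fun x => (h x - c) / R) = energy G h / R ^ 2 := by
  simp only [energy, Finset.mul_sum, Finset.sum_div]
  refine Finset.sum_congr rfl fun x _ => Finset.sum_congr rfl fun y _ => ?_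
  split_ifs <;> ring

/-- A potential for the unit flow from `u` to `v` computes the resistance distance. -/
theorem resistanceDistance_eq_of_potential [Fintype V] (G : SimpleGraph V) {u v : V} {h : V → ℝ}
    (hh : ∀ f, dirichletForm G f h = f u - f v) :
    resistanceDistance G u v = h u - h v := by
  unfold resistanceDistance
  split_ifs with huv
  · simp [huv]
  set R := h u - h v with hR
  have hRE : energy G h = R := by rw [energy_eq_dirichletForm, hh]
  have key : ∀ f : V → ℝ, f u = 1 → f v = 0 → ∀ s : ℝ, 0 ≤ energy G f - 2 * s + s ^ 2 * R := by
    intro f hu hv s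
    have := energy_nonneg G (fun x => f x - s * h x)
    rw [energy_sub_mul, hh, hu, hv, hRE] at this
    linarith
  have hpos : 0 < R := by
    refine lt_of_le_of_ne (hRE ▸ energy_nonneg G h) fun h0 => ?_
    have := key (fun x => if x = u then 1 else 0) (by simp) (by simp [Ne.symm huv])
      (energy G (fun x => if x = u then 1 else 0) + 1)
    rw [← h0] at this
    have h1 := energy_nonneg G (fun x => if x = u then 1 else 0)
    linarith
  have hleast : IsLeast {e : ℝ | ∃ f : V → ℝ, f u = 1 ∧ f v = 0 ∧ energy G f = e} (1 / R) := by
    constructor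
    · refine ⟨fun x => (h x - h v) / R, div_self hpos.ne', by simp, ?_⟩
      rw [energy_sub_const_div, hRE]
      field_simp
    · rintro e ⟨f, hu, hv, rfl⟩
      have := key f hu hv (1 / R)
      have h2 : (1 / R) ^ 2 * R = 1 / R := by field_simp
      rw [h2] at this
      linarith
  rw [hleast.csInf_eq, one_div_one_div]

/-- The Dirichlet form of a graph consisting of the tree with parent function `q` and root `o`
together with one extra edge joining `o` and `a`. -/
theorem dirichletForm_eq_of_parent {n : ℕ} (G : SimpleGraph (Fin n)) (q : Fin n → Fin n)
    (o a : Fin n) (ho : o.val = 0) (hqo : q o = o) (hq : ∀ w, w ≠ o → q w < w)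
    (hao : a ≠ o) (hqa : q a ≠ o)
    (hG : ∀ x y, G.Adj x y ↔
      ((y ≠ o ∧ x = q y) ∨ (x = o ∧ y = a)) ∨ ((x ≠ o ∧ y = q x) ∨ (y = o ∧ x = a)))
    (f g : Fin n → ℝ) :
    dirichletForm G f g
      = ∑ w, (f w - f (q w)) * (g w - g (q w)) + (f a - f o) * (g a - g o) := by
  have hoa : o < a := by
    rw [Fin.lt_def, ho]
    exact Nat.pos_of_ne_zero fun h => hao (Fin.ext (h.trans ho.symm))
  have hdir : ∀ x y, (if G.Adj x y then (f x - f y) * (g x - g y) else 0)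
      = (((if x = q y then (f y - f (q y)) * (g y - g (q y)) else 0)
          + (if x = o then if y = a then (f a - f o) * (g a - g o) else 0 else 0))
        + ((if y = q x then (f x - f (q x)) * (g x - g (q x)) else 0)
          + (if y = o then if x = a then (f a - f o) * (g a - g o) else 0 else 0))) := by
    intro x y
    have hx := hq x
    have hy := hq y
    by_cases hxo : x = o <;> by_cases hyo : y = o
    · subst hxo; subst hyo
      simp [hqo, hao.symm]
    · subst hxo
      have h1 : y ≠ q x := by rw [hqo]; exact hyo
      by_cases hya : y = a
      · subst hya
        simp [hG, h1, hqa.symm, hyo]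
        ring
      · by_cases h2 : x = q y
        · simp [hG, h1, hyo, hya, ← h2]
          ring
        · simp [hG, h1, hyo, hya, h2]
    · subst hyo
      have h1 : x ≠ q y := by rw [hqo]; exact hxo
      by_cases hxa : x = a
      · subst hxa
        simp [hG, h1, hqa.symm, hxo]
      · by_cases h2 : y = q x
        · simp [hG, h1, hxo, hxa, ← h2]
        · simp [hG, h1, hxo, hxa, h2]
    · by_cases h1 : x = q y
      · have h2 : y ≠ q x := fun h => by
          have h3 := hx hxo
          have h4 := hy hyo
          rw [← h] at h3
          rw [← h1] at h4
          exact lt_asymm h3 h4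
        have hadj : G.Adj x y := (hG x y).2 (Or.inl (Or.inl ⟨hyo, h1⟩))
        rw [if_pos hadj, if_pos h1, if_neg hxo, if_neg h2, if_neg hyo, h1]
        ring
      · by_cases h2 : y = q x
        · have hadj : G.Adj x y := (hG x y).2 (Or.inr (Or.inl ⟨hxo, h2⟩))
          rw [if_pos hadj, if_neg h1, if_neg hxo, if_pos h2, if_neg hyo, h2]
          ring
        · simp [hG, hxo, hyo, h1, h2]
  unfold dirichletForm
  simp only [hdir, Finset.sum_add_distrib]
  rw [Finset.sum_comm]
  simp
  ring

/-- Kirchhoff index of a tree plus one edge `oa` at the root `o`, where `A k w` indicates that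
`k` is a non-root ancestor of `w`: the Wiener index of the tree with a rank-one correction. -/
theorem kirchhoffIndex_eq_of_parent {n : ℕ} (G : SimpleGraph (Fin n)) (q : Fin n → Fin n)
    (o a : Fin n) (ho : o.val = 0) (hqo : q o = o) (hq : ∀ w, w ≠ o → q w < w)
    (hao : a ≠ o) (hqa : q a ≠ o)
    (hG : ∀ x y, G.Adj x y ↔
      ((y ≠ o ∧ x = q y) ∨ (x = o ∧ y = a)) ∨ ((x ≠ o ∧ y = q x) ∨ (y = o ∧ x = a)))
    (A : Fin n → Fin n → ℝ) (hAo : ∀ k, A k o = 0)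
    (hA : ∀ w, w ≠ o → ∀ k, A k w = A k (q w) + if k = w then 1 else 0) :
    kirchhoffIndex G = (1 / 2) * ∑ u, ∑ v, ∑ k, (A k u - A k v) ^ 2
      - (1 / 2) * ∑ u, ∑ v, (∑ k, A k a * A k u - ∑ k, A k a * A k v) ^ 2
          / (1 + ∑ k, A k a * A k a) := by
  have tele : ∀ (f : Fin n → ℝ) (u : Fin n), ∑ w, (f w - f (q w)) * A w u = f u - f o := by
    intro f u
    induction u using WellFoundedLT.induction with
    | ind u ih =>
      by_cases hu : u = o
      · simp [hu, hAo]
      · simp only [hA u hu, mul_add, Finset.sum_add_distrib, ih (q u) (hq u hu)]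
        simp
  have grad : ∀ u w, ∑ k, A k u * A k w - ∑ k, A k u * A k (q w)
      = if w = o then 0 else A w u := by
    intro u w
    split_ifs with hw
    · simp [hw, hqo]
    · simp [hA w hw, mul_add, Finset.sum_add_distrib]
  have green : ∀ (f : Fin n → ℝ) (u : Fin n),
      ∑ w, (f w - f (q w)) * (∑ k, A k u * A k w - ∑ k, A k u * A k (q w)) = f u - f o := by
    intro f u
    rw [← tele f u]
    refine Finset.sum_congr rfl fun w _ => ?_
    rw [grad]
    split_ifs with hw
    · simp [hw, hqo]
    · rfl
  have symm : ∀ u w, ∑ k, A k u * A k w = ∑ k, A k w * A k u := fun u w =>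
    Finset.sum_congr rfl fun k _ => mul_comm _ _
  set T : Fin n → Fin n → ℝ := fun u w => ∑ k, A k u * A k w with hT
  have hTo : ∀ u, T u o = 0 := by simp [hT, hAo]
  have hpos : 0 < 1 + T a a := by
    have : 0 ≤ T a a := Finset.sum_nonneg fun k _ => mul_self_nonneg _
    linarith
  have hr : ∀ u v, resistanceDistance G u v
      = ∑ k, (A k u - A k v) ^ 2 - (T a u - T a v) ^ 2 / (1 + T a a) := by
    intro u v
    obtain ⟨α, hα⟩ : ∃ α, α = (T a u - T a v) / (1 + T a a) := ⟨_, rfl⟩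
    have hα' : α * (1 + T a a) = T a u - T a v := by rw [hα]; field_simp
    have h1 := resistanceDistance_eq_of_potential G (u := u) (v := v)
      (h := fun w => T u w - T v w - α * T a w) (by
        intro f
        rw [dirichletForm_eq_of_parent G q o a ho hqo hq hao hqa hG]
        have h2 : ∑ w, (f w - f (q w)) * ((T u w - T v w - α * T a w)
              - (T u (q w) - T v (q w) - α * T a (q w)))
            = (f u - f o) - (f v - f o) - α * (f a - f o) := by
          rw [← green f u, ← green f v, ← green f a, Finset.mul_sum,
            ← Finset.sum_sub_distrib, ← Finset.sum_sub_distrib]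
          refine Finset.sum_congr rfl fun w _ => ?_
          simp only [hT]
          ring
        rw [h2, hTo, hTo, hTo, show T u a = T a u from symm u a, show T v a = T a v from symm v a]
        linear_combination (-(f a - f o)) * hα')
    have h3 : ∑ k, (A k u - A k v) ^ 2 = T u u - 2 * T u v + T v v := by
      simp only [hT, Finset.mul_sum, ← Finset.sum_sub_distrib, ← Finset.sum_add_distrib]
      exact Finset.sum_congr rfl fun k _ => by ring
    have h4 : (T a u - T a v) ^ 2 / (1 + T a a) = α * (T a u - T a v) := by
      rw [hα]; ring
    have h5 : T v u = T u v := symm v u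
    rw [h1, h3, h4]
    linear_combination -h5
  simp only [kirchhoffIndex, hr, Finset.sum_sub_distrib, mul_sub, hT]

/-- Summing the squared differences of an indicator over pairs counts the separated pairs. -/
theorem half_sum_sum_sub_sq {ι κ : Type*} [Fintype ι] [Fintype κ] (P : κ → ι → Prop) :
    (1 / 2 : ℝ) * ∑ u : ι, ∑ v : ι, ∑ k : κ,
        ((if P k u then (1 : ℝ) else 0) - if P k v then 1 else 0) ^ 2
      = ∑ k : κ, (∑ u : ι, if P k u then (1 : ℝ) else 0)
          * (Fintype.card ι - ∑ u : ι, if P k u then (1 : ℝ) else 0) := by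
  have h1 : ∀ u, ∑ v : ι, ∑ k : κ,
        ((if P k u then (1 : ℝ) else 0) - if P k v then 1 else 0) ^ 2
      = ∑ k : κ, ∑ v : ι, ((if P k u then (1 : ℝ) else 0) - if P k v then 1 else 0) ^ 2 :=
    fun u => Finset.sum_comm
  simp only [h1]
  rw [Finset.sum_comm, Finset.mul_sum]
  refine Finset.sum_congr rfl fun k _ => ?_
  have h2 : ∀ u v, ((if P k u then (1 : ℝ) else 0) - if P k v then 1 else 0) ^ 2
      = (if P k u then (1 : ℝ) else 0) + (if P k v then (1 : ℝ) else 0)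
        - 2 * ((if P k u then (1 : ℝ) else 0) * if P k v then (1 : ℝ) else 0) := by
    intro u v
    split_ifs <;> norm_num
  simp only [h2, Finset.sum_sub_distrib, Finset.sum_add_distrib, ← Finset.mul_sum,
    ← Finset.sum_mul, Finset.sum_const, Finset.card_univ, nsmul_eq_mul]
  ring

theorem sum_const_sub_mul (M : ℕ) (N c : ℝ) :
    ∑ j ∈ Finset.range M, (N - (c + j)) * (c + j)
      = (N * c - c ^ 2) * M + (N - 2 * c) * (M * (M - 1) / 2)
        - M * (M - 1) * (2 * M - 1) / 6 := by
  induction M with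
  | zero => simp
  | succ M ih =>
    rw [Finset.sum_range_succ, ih]
    push_cast
    ring

theorem sum_ite_fin_eq_card {n : ℕ} (P : ℕ → Prop) (s : Finset ℕ)
    (h : ∀ w, w ∈ s ↔ w < n ∧ P w) :
    ∑ w : Fin n, (if P w.val then (1 : ℝ) else 0) = s.card := by
  rw [Fin.sum_univ_eq_sum_range (fun w => if P w then (1 : ℝ) else 0), Finset.sum_boole]
  congr 2
  ext w
  simp [h]

/-- Parent function of the spanning tree of `Ga n l Δ` missing the edge `{0, l - 1}`. -/
def parentA (l Δ w : ℕ) : ℕ :=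
  if w < l then w - 1 else if w ≤ l + Δ - 3 then 0 else w - 1

/-- `k` is a non-root ancestor of `w` in the spanning tree of `Ga n l Δ`. -/
def AncestorA (l Δ k w : ℕ) : Prop :=
  1 ≤ k ∧ ((k ≤ w ∧ w < l) ∨ (l ≤ w ∧ k = w) ∨ (l + Δ - 3 ≤ k ∧ k ≤ w))

/-- Parent function of the spanning tree of `Gb n l Δ` missing the edge `{0, l - 1}`. -/
def parentB (n l Δ w : ℕ) : ℕ :=
  if w < l then w - 1 else if w = l then 0 else if w ≤ n - Δ then w - 1 else n - Δ

/-- `k` is a non-root ancestor of `w` in the spanning tree of `Gb n l Δ`. -/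
def AncestorB (n l Δ k w : ℕ) : Prop :=
  1 ≤ k ∧ ((k ≤ w ∧ w < l) ∨ (l ≤ k ∧ k ≤ w ∧ k ≤ n - Δ) ∨ (l ≤ w ∧ k = w))

theorem parentA_le (l Δ w : ℕ) : parentA l Δ w ≤ w := by
  unfold parentA; split_ifs <;> omega

theorem parentB_le (n l Δ w : ℕ) : parentB n l Δ w ≤ w := by
  unfold parentB; split_ifs <;> omega

theorem kirchhoffIndex_Ga (n l Δ : ℕ) (hl : 3 ≤ l) (hΔ : 3 ≤ Δ) (a : Fin n)
    (ha : a.val = l - 1) (A : Fin n → Fin n → ℝ)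
    (hA : A = fun k w => if AncestorA l Δ k.val w.val then 1 else 0) :
    kirchhoffIndex (Ga n l Δ) = (1 / 2) * ∑ u, ∑ v, ∑ k, (A k u - A k v) ^ 2
      - (1 / 2) * ∑ u, ∑ v, (∑ k, A k a * A k u - ∑ k, A k a * A k v) ^ 2
          / (1 + ∑ k, A k a * A k a) := by
  subst hA
  refine kirchhoffIndex_eq_of_parent (Ga n l Δ)
    (fun w => ⟨parentA l Δ w, (parentA_le l Δ w).trans_lt w.isLt⟩)
    ⟨0, a.pos⟩ a rfl ?_ ?_ ?_ ?_ ?_ _ ?_ ?_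
  · simp [parentA]
  · intro w hw
    simp only [ne_eq, Fin.ext_iff] at hw
    simp only [Fin.lt_def, parentA]
    split_ifs <;> omega
  · simp only [ne_eq, Fin.ext_iff]; omega
  · simp only [ne_eq, Fin.ext_iff, parentA]; split_ifs <;> omega
  · intro x y
    simp only [Ga, SimpleGraph.fromRel_adj, ne_eq, Fin.ext_iff, parentA]
    split_ifs <;> omega
  · intro k
    simp [AncestorA]; omega
  · intro w hw k
    simp only [ne_eq, Fin.ext_iff] at hw
    have h : (AncestorA l Δ k w ↔ (AncestorA l Δ k (parentA l Δ w) ∨ k.val = w.val))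
        ∧ ¬ (AncestorA l Δ k (parentA l Δ w) ∧ k.val = w.val) := by
      unfold AncestorA parentA
      split_ifs <;> omega
    by_cases h1 : AncestorA l Δ k (parentA l Δ w) <;> by_cases h2 : k.val = w.val <;>
      simp_all [Fin.ext_iff]

theorem kirchhoffIndex_Gb (n l Δ : ℕ) (hl : 3 ≤ l) (hn : l + Δ ≤ n) (a : Fin n)
    (ha : a.val = l - 1) (A : Fin n → Fin n → ℝ)
    (hA : A = fun k w => if AncestorB n l Δ k.val w.val then 1 else 0) :
    kirchhoffIndex (Gb n l Δ) = (1 / 2) * ∑ u, ∑ v, ∑ k, (A k u - A k v) ^ 2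
      - (1 / 2) * ∑ u, ∑ v, (∑ k, A k a * A k u - ∑ k, A k a * A k v) ^ 2
          / (1 + ∑ k, A k a * A k a) := by
  subst hA
  refine kirchhoffIndex_eq_of_parent (Gb n l Δ)
    (fun w => ⟨parentB n l Δ w, (parentB_le n l Δ w).trans_lt w.isLt⟩)
    ⟨0, by omega⟩ a rfl ?_ ?_ ?_ ?_ ?_ _ ?_ ?_
  · simp [parentB]
  · intro w hw
    simp only [ne_eq, Fin.ext_iff] at hw
    simp only [Fin.lt_def, parentB]
    split_ifs <;> omega
  · simp only [ne_eq, Fin.ext_iff]; omega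
  · simp only [ne_eq, Fin.ext_iff, parentB]; split_ifs <;> omega
  · intro x y
    simp only [Gb, SimpleGraph.fromRel_adj, ne_eq, Fin.ext_iff, parentB]
    split_ifs <;> omega
  · intro k
    simp [AncestorB]; omega
  · intro w hw k
    simp only [ne_eq, Fin.ext_iff] at hw
    have h : (AncestorB n l Δ k w ↔ (AncestorB n l Δ k (parentB n l Δ w) ∨ k.val = w.val))
        ∧ ¬ (AncestorB n l Δ k (parentB n l Δ w) ∧ k.val = w.val) := by
      unfold AncestorB parentB
      split_ifs <;> omega
    by_cases h1 : AncestorB n l Δ k (parentB n l Δ w) <;> by_cases h2 : k.val = w.val <;>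
      simp_all [Fin.ext_iff]

/-- Size of the subtree below the edge from `k` to its parent in the tree of `Ga n l Δ`. -/
def subtreeSizeA (n l Δ k : ℕ) : ℕ :=
  if k = 0 then 0 else if k < l then l - k else if k < l + Δ - 3 then 1 else n - k

/-- Size of the subtree below the edge from `k` to its parent in the tree of `Gb n l Δ`. -/
def subtreeSizeB (n l Δ k : ℕ) : ℕ :=
  if k = 0 then 0 else if k < l then l - k else if k ≤ n - Δ then n - k else 1

theorem sum_ancestorA {n l Δ : ℕ} (hΔ : 3 ≤ Δ) (hn : l + Δ ≤ n) (k : Fin n) :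
    ∑ w : Fin n, (if AncestorA l Δ k w then (1 : ℝ) else 0) = subtreeSizeA n l Δ k := by
  have hk := k.isLt
  unfold subtreeSizeA
  split_ifs with h0 h1 h2
  · rw [sum_ite_fin_eq_card (AncestorA l Δ k) ∅ (by intro w; simp [AncestorA]; omega)]
    simp
  · rw [sum_ite_fin_eq_card (AncestorA l Δ k) (Finset.Ico k.val l)
      (by intro w; simp only [AncestorA, Finset.mem_Ico]; omega)]
    simp
  · rw [sum_ite_fin_eq_card (AncestorA l Δ k) {k.val}
      (by intro w; simp only [AncestorA, Finset.mem_singleton]; omega)]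
    simp
  · rw [sum_ite_fin_eq_card (AncestorA l Δ k) (Finset.Ico k.val n)
      (by intro w; simp only [AncestorA, Finset.mem_Ico]; omega)]
    simp

theorem sum_ancestorB {n l Δ : ℕ} (hn : l + Δ ≤ n) (k : Fin n) :
    ∑ w : Fin n, (if AncestorB n l Δ k w then (1 : ℝ) else 0) = subtreeSizeB n l Δ k := by
  have hk := k.isLt
  unfold subtreeSizeB
  split_ifs with h0 h1 h2
  · rw [sum_ite_fin_eq_card (AncestorB n l Δ k) ∅ (by intro w; simp [AncestorB]; omega)]
    simp
  · rw [sum_ite_fin_eq_card (AncestorB n l Δ k) (Finset.Ico k.val l)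
      (by intro w; simp only [AncestorB, Finset.mem_Ico]; omega)]
    simp
  · rw [sum_ite_fin_eq_card (AncestorB n l Δ k) (Finset.Ico k.val n)
      (by intro w; simp only [AncestorB, Finset.mem_Ico]; omega)]
    simp
  · rw [sum_ite_fin_eq_card (AncestorB n l Δ k) {k.val}
      (by intro w; simp only [AncestorB, Finset.mem_singleton]; omega)]
    simp

theorem sum_subtreeSizeA_sub_sum_subtreeSizeB {n l Δ : ℕ} (hl : 1 ≤ l) (hΔ : 3 ≤ Δ)
    (hn : l + Δ ≤ n) :
    ∑ k : Fin n, (subtreeSizeA n l Δ k : ℝ) * (n - subtreeSizeA n l Δ k)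
        - ∑ k : Fin n, (subtreeSizeB n l Δ k : ℝ) * (n - subtreeSizeB n l Δ k)
      = ((Δ : ℝ) - 3) * (l : ℝ) ^ 2 + ((Δ : ℝ) - 3) * ((Δ : ℝ) - (n : ℝ) - 4) * (l : ℝ)
        - 8 * (n : ℝ) + 12 * (Δ : ℝ) + 3 * (n : ℝ) * (Δ : ℝ) - 3 * (Δ : ℝ) ^ 2 - 12 := by
  rw [Fin.sum_univ_eq_sum_range
      (fun k => (subtreeSizeA n l Δ k : ℝ) * (n - subtreeSizeA n l Δ k)),
    Fin.sum_univ_eq_sum_range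
      (fun k => (subtreeSizeB n l Δ k : ℝ) * (n - subtreeSizeB n l Δ k))]
  obtain ⟨D, rfl⟩ := Nat.exists_eq_add_of_le hΔ
  obtain ⟨t, ht⟩ := Nat.exists_eq_add_of_le hn
  have hA : Finset.range n = Finset.range (l + (D + (t + 3))) := by congr 1; omega
  have hB : Finset.range n = Finset.range (l + ((t + 1) + (D + 2))) := by congr 1; omega
  have hnR : (n : ℝ) = l + (3 + D) + t := by rw [ht]; push_cast; ring
  nth_rewrite 1 [hA]
  rw [hB]
  rw [Finset.sum_range_add _ l (D + (t + 3)), Finset.sum_range_add _ D (t + 3),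
    Finset.sum_range_add _ l (t + 1 + (D + 2)), Finset.sum_range_add _ (t + 1) (D + 2)]
  have e1 : ∀ k ∈ Finset.range l, subtreeSizeA n l (3 + D) k = subtreeSizeB n l (3 + D) k := by
    intro k hk
    rw [Finset.mem_range] at hk
    simp [subtreeSizeA, subtreeSizeB, hk]
  have e2 : ∀ k ∈ Finset.range D, subtreeSizeA n l (3 + D) (l + k) = 1 := by
    intro k hk
    rw [Finset.mem_range] at hk
    unfold subtreeSizeA
    split_ifs <;> omega
  have e3 : ∀ k ∈ Finset.range (t + 3),
      (subtreeSizeA n l (3 + D) (l + (D + k)) : ℝ) = n - ((l + D) + k) := by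
    intro k hk
    rw [Finset.mem_range] at hk
    have h : subtreeSizeA n l (3 + D) (l + (D + k)) + (l + D + k) = n := by
      unfold subtreeSizeA
      split_ifs <;> omega
    exact eq_sub_of_add_eq (by exact_mod_cast h)
  have e4 : ∀ k ∈ Finset.range (t + 1),
      (subtreeSizeB n l (3 + D) (l + k) : ℝ) = n - (l + k) := by
    intro k hk
    rw [Finset.mem_range] at hk
    have h : subtreeSizeB n l (3 + D) (l + k) + (l + k) = n := by
      unfold subtreeSizeB
      split_ifs <;> omega
    exact eq_sub_of_add_eq (by exact_mod_cast h)
  have e5 : ∀ k ∈ Finset.range (D + 2), subtreeSizeB n l (3 + D) (l + ((t + 1) + k)) = 1 := by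
    intro k hk
    unfold subtreeSizeB
    split_ifs <;> omega
  rw [Finset.sum_congr rfl fun k hk => by rw [e1 k hk],
    Finset.sum_congr (s₁ := Finset.range D) rfl fun k hk => by rw [e2 k hk],
    Finset.sum_congr (s₁ := Finset.range (t + 3)) rfl fun k hk => by rw [e3 k hk, sub_sub_cancel],
    Finset.sum_congr (s₁ := Finset.range (t + 1)) rfl fun k hk => by rw [e4 k hk, sub_sub_cancel],
    Finset.sum_congr (s₁ := Finset.range (D + 2)) rfl fun k hk => by rw [e5 k hk],
    sum_const_sub_mul, sum_const_sub_mul]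
  simp only [Finset.sum_const, Finset.card_range, nsmul_eq_mul, hnR]
  push_cast
  ring

/-- The closed-form difference of the Kirchhoff indices of `G_a` and `G_b`. -/
theorem statement7 (n l Δ : ℕ) (hl : 3 ≤ l) (hΔ : 3 ≤ Δ) (hn : l + Δ ≤ n) :
    kirchhoffIndex (Ga n l Δ) - kirchhoffIndex (Gb n l Δ)
      = ((Δ : ℝ) - 3) * (l : ℝ) ^ 2 + ((Δ : ℝ) - 3) * ((Δ : ℝ) - (n : ℝ) - 4) * (l : ℝ)
        - 8 * (n : ℝ) + 12 * (Δ : ℝ) + 3 * (n : ℝ) * (Δ : ℝ) - 3 * (Δ : ℝ) ^ 2 - 12 := by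
  have hc : ∀ (k : Fin n) (w : ℕ), ((if AncestorA l Δ k (l - 1) then (1 : ℝ) else 0)
        * if AncestorA l Δ k w then 1 else 0)
      = (if AncestorB n l Δ k (l - 1) then (1 : ℝ) else 0)
        * if AncestorB n l Δ k w then 1 else 0 := by
    intro k w
    have h1 : AncestorA l Δ k (l - 1) ↔ 1 ≤ k.val ∧ k.val < l := by
      unfold AncestorA; omega
    have h2 : AncestorB n l Δ k (l - 1) ↔ 1 ≤ k.val ∧ k.val < l := by
      unfold AncestorB; omega
    by_cases hk : 1 ≤ k.val ∧ k.val < l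
    · have h3 : AncestorA l Δ k w ↔ AncestorB n l Δ k w := by
        unfold AncestorA AncestorB; omega
      simp only [h1, h2, h3]
    · simp [h1, h2, hk]
  rw [kirchhoffIndex_Ga n l Δ hl hΔ ⟨l - 1, by omega⟩ rfl _ rfl,
    kirchhoffIndex_Gb n l Δ hl hn ⟨l - 1, by omega⟩ rfl _ rfl]
  simp only [hc]
  rw [sub_sub_sub_cancel_right, half_sum_sum_sub_sq (fun k w : Fin n => AncestorA l Δ k w),
    half_sum_sum_sub_sq (fun k w : Fin n => AncestorB n l Δ k w)]
  simp only [sum_ancestorA hΔ hn, sum_ancestorB hn, Fintype.card_fin]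
  exact sum_subtreeSizeA_sub_sum_subtreeSizeB (by omega) hΔ hn

end KfPaper
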